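/- Let n be even, n ≥ 2, and let Q : 𝔽₂ⁿ → 𝔽₂ⁿ be pure quadratic such that every component Q_λ (λ ≠ 0) is either bent or semi-bent. Then Q is APN if and only if the number of nonzero λ ∈ 𝔽₂ⁿ for which Q_λ is bent equals 2(2ⁿ−1)/3. -/

import Mathlib

/-- The derivative of a Boolean function at `a`. -/
def Dop {α : Type*} [Add α] (a : α) (f : α → ZMod 2) : α → ZMod 2 :=
  fun x => f (x + a) + f x

/-- `degLE d f` means the algebraic degree of `f` is at most `d`:
all `(d+1)`-fold iterated derivatives vanish. -/
def degLE {α : Type*} [Add α] (d : ℕ) (f : α → ZMod 2) : Prop :=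
  ∀ l : List α, l.length = d + 1 → l.foldr Dop f = fun _ => 0

/-- The component `F_λ` of a vectorial Boolean function: `x ↦ λ · F(x)` (dot product mod 2). -/
def comp {n : ℕ} (lam : Fin n → ZMod 2) (F : (Fin n → ZMod 2) → (Fin n → ZMod 2)) :
    (Fin n → ZMod 2) → ZMod 2 :=
  fun x => ∑ i, lam i * F x i

/-- `F` is APN: for every nonzero `a` and every `b`, `F(x+a) + F(x) = b` has at most
2 solutions. -/
def IsAPN {n : ℕ} (F : (Fin n → ZMod 2) → (Fin n → ZMod 2)) : Prop :=
  ∀ a : Fin n → ZMod 2, a ≠ 0 → ∀ b : Fin n → ZMod 2,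
    (Finset.univ.filter fun x => F (x + a) + F x = b).card ≤ 2

/-- The Walsh transform of a Boolean function on `n` variables. -/
def walsh {n : ℕ} (f : (Fin n → ZMod 2) → ZMod 2) (a : Fin n → ZMod 2) : ℤ :=
  ∑ x : Fin n → ZMod 2, (-1 : ℤ) ^ ((f x + ∑ i, a i * x i).val)

/-- For `n` even: `f` is bent if its Walsh transform takes only the values `±2^(n/2)`. -/
def IsBentW {n : ℕ} (f : (Fin n → ZMod 2) → ZMod 2) : Prop :=
  ∀ a : Fin n → ZMod 2, walsh f a = 2 ^ (n / 2) ∨ walsh f a = -2 ^ (n / 2)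

/-- For `n` even: `f` is semi-bent if its Walsh transform takes only the values
`0, ±2^((n+2)/2)`. -/
def IsSemiBentW {n : ℕ} (f : (Fin n → ZMod 2) → ZMod 2) : Prop :=
  ∀ a : Fin n → ZMod 2,
    walsh f a = 0 ∨ walsh f a = 2 ^ ((n + 2) / 2) ∨ walsh f a = -2 ^ ((n + 2) / 2)

/-- The sign character `c ↦ (-1)^c` of `ZMod 2`, with integer values. -/
def signChar (c : ZMod 2) : ℤ := (-1) ^ c.val

theorem signChar_add (a b : ZMod 2) : signChar (a + b) = signChar a * signChar b := by
  revert a b; decide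

theorem signChar_sq (a : ZMod 2) : signChar a ^ 2 = 1 := by
  revert a; decide

theorem signChar_zero : signChar 0 = 1 := rfl

theorem add_self_two {n : ℕ} (x : Fin n → ZMod 2) : x + x = 0 :=
  funext fun i => CharTwo.add_self_eq_zero (x i)

theorem add_eq_zero_two {n : ℕ} (x y : Fin n → ZMod 2) : x + y = 0 ↔ x = y := by
  simp only [funext_iff, Pi.add_apply, Pi.zero_apply, CharTwo.add_eq_zero]

theorem card_cube (n : ℕ) : Fintype.card (Fin n → ZMod 2) = 2 ^ n := by
  simp [ZMod.card]

theorem sum_signChar_dot {n : ℕ} (v : Fin n → ZMod 2) :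
    ∑ u : Fin n → ZMod 2, signChar (∑ i, u i * v i) = if v = 0 then 2 ^ n else 0 := by
  split_ifs with h
  · simp [h, signChar_zero, ZMod.card]
  · obtain ⟨i, hi⟩ := Function.ne_iff.1 h
    have hi1 : v i = 1 := Fin.eq_one_of_ne_zero _ hi
    have key := Equiv.sum_comp (Equiv.addRight (Pi.single i 1 : Fin n → ZMod 2))
      (fun u => signChar (∑ j, u j * v j))
    have hs : ∀ u : Fin n → ZMod 2,
        signChar (∑ j, (u + Pi.single i 1 : Fin n → ZMod 2) j * v j) = -signChar (∑ j, u j * v j) := by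
      intro u
      have : ∑ j, (u + Pi.single i 1 : Fin n → ZMod 2) j * v j = ∑ j, u j * v j + 1 := by
        simp [add_mul, Finset.sum_add_distrib, Pi.single_apply, hi1]
      rw [this, signChar_add]
      simp [signChar, ZMod.val_one]
    simp only [Equiv.coe_addRight, hs, Finset.sum_neg_distrib] at key
    linarith

/-- The Fourier transform on `𝔽₂ⁿ` of an integer-valued function. -/
def cubeFourier {n : ℕ} (g : (Fin n → ZMod 2) → ℤ) (u : Fin n → ZMod 2) : ℤ :=
  ∑ x, g x * signChar (∑ i, u i * x i)

theorem sum_cubeFourier_sq {n : ℕ} (g : (Fin n → ZMod 2) → ℤ) :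
    ∑ u, cubeFourier g u ^ 2 = 2 ^ n * ∑ x, g x ^ 2 := by
  have h : ∀ u, cubeFourier g u ^ 2 =
      ∑ x, ∑ y, g x * g y * signChar (∑ i, u i * (x + y) i) := by
    intro u
    rw [sq, cubeFourier, Finset.sum_mul_sum]
    refine Finset.sum_congr rfl fun x _ => Finset.sum_congr rfl fun y _ => ?_
    simp only [Pi.add_apply, mul_add, Finset.sum_add_distrib, signChar_add]
    ring
  simp only [h]
  rw [Finset.sum_comm, Finset.mul_sum]
  refine Finset.sum_congr rfl fun x _ => ?_
  rw [Finset.sum_comm]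
  simp only [← Finset.mul_sum, sum_signChar_dot, add_eq_zero_two]
  simp
  ring

theorem walsh_eq_cubeFourier {n : ℕ} (f : (Fin n → ZMod 2) → ZMod 2) :
    walsh f = cubeFourier fun x => signChar (f x) := by
  funext u
  simp only [walsh, cubeFourier, ← signChar_add]
  rfl

theorem sum_walsh_sq {n : ℕ} (f : (Fin n → ZMod 2) → ZMod 2) :
    ∑ u, walsh f u ^ 2 = 2 ^ n * 2 ^ n := by
  rw [walsh_eq_cubeFourier, sum_cubeFourier_sq]
  simp [signChar_sq, ZMod.card]

/-- The autocorrelation of a Boolean function. -/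
def autocorr {n : ℕ} (f : (Fin n → ZMod 2) → ZMod 2) (a : Fin n → ZMod 2) : ℤ :=
  ∑ x, signChar (Dop a f x)

theorem walsh_sq {n : ℕ} (f : (Fin n → ZMod 2) → ZMod 2) (u : Fin n → ZMod 2) :
    walsh f u ^ 2 = cubeFourier (autocorr f) u := by
  rw [walsh_eq_cubeFourier, sq]
  simp only [cubeFourier, autocorr]
  rw [Finset.sum_mul_sum]
  simp only [Finset.sum_mul]
  rw [Finset.sum_comm (s := Finset.univ) (t := Finset.univ)
    (f := fun a x => signChar (Dop a f x) * signChar (∑ i, u i * a i))]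
  refine Finset.sum_congr rfl fun x _ => ?_
  rw [← Equiv.sum_comp (Equiv.addLeft x)]
  refine Finset.sum_congr rfl fun a _ => ?_
  simp only [Equiv.coe_addLeft, Dop, Pi.add_apply, mul_add, Finset.sum_add_distrib, signChar_add]
  linear_combination (signChar (f x) * signChar (f (x + a)) * signChar (∑ i, u i * a i)) *
    signChar_sq (∑ i, u i * x i)

theorem sum_walsh_pow_four {n : ℕ} (f : (Fin n → ZMod 2) → ZMod 2) :
    ∑ u, walsh f u ^ 4 = 2 ^ n * ∑ a, autocorr f a ^ 2 := by
  rw [← sum_cubeFourier_sq]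
  refine Finset.sum_congr rfl fun u _ => ?_
  rw [← walsh_sq]
  ring

/-- The number of solutions of `F (x + a) + F x = b`. -/
def diffCount {n : ℕ} (F : (Fin n → ZMod 2) → (Fin n → ZMod 2)) (a b : Fin n → ZMod 2) : ℕ :=
  (Finset.univ.filter fun x => F (x + a) + F x = b).card

theorem autocorr_comp {n : ℕ} (F : (Fin n → ZMod 2) → (Fin n → ZMod 2))
    (lam a : Fin n → ZMod 2) :
    autocorr (comp lam F) a = cubeFourier (fun b => (diffCount F a b : ℤ)) lam := by
  simp only [cubeFourier, autocorr, diffCount]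
  rw [← Finset.sum_fiberwise (s := Finset.univ) (g := fun x => F (x + a) + F x)]
  refine Finset.sum_congr rfl fun b _ => ?_
  rw [← nsmul_eq_mul]
  refine Finset.sum_eq_card_nsmul fun x hx => ?_
  rw [← (Finset.mem_filter.1 hx).2]
  simp [Dop, comp, mul_add, Finset.sum_add_distrib]

theorem sum_sum_walsh_pow_four {n : ℕ} (F : (Fin n → ZMod 2) → (Fin n → ZMod 2)) :
    ∑ lam, ∑ u, walsh (comp lam F) u ^ 4 =
      2 ^ n * 2 ^ n * ∑ a, ∑ b, (diffCount F a b : ℤ) ^ 2 := by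
  simp only [sum_walsh_pow_four, autocorr_comp]
  rw [← Finset.mul_sum, Finset.sum_comm]
  simp only [sum_cubeFourier_sq]
  rw [← Finset.mul_sum, mul_assoc]

theorem sum_diffCount {n : ℕ} (F : (Fin n → ZMod 2) → (Fin n → ZMod 2)) (a : Fin n → ZMod 2) :
    ∑ b, (diffCount F a b : ℤ) = 2 ^ n := by
  have h := Finset.card_eq_sum_card_fiberwise (s := Finset.univ) (t := Finset.univ)
    (f := fun x => F (x + a) + F x) (fun _ _ => Finset.mem_coe.2 (Finset.mem_univ _))
  rw [Finset.card_univ, card_cube] at h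
  exact_mod_cast h.symm

theorem sum_diffCount_zero_sq {n : ℕ} (F : (Fin n → ZMod 2) → (Fin n → ZMod 2)) :
    ∑ b, (diffCount F 0 b : ℤ) ^ 2 = 2 ^ n * 2 ^ n := by
  have h : ∀ b, (diffCount F 0 b : ℤ) = if b = 0 then 2 ^ n else 0 := by
    intro b
    rcases eq_or_ne b 0 with rfl | hb
    · simp [diffCount, add_self_two, ZMod.card]
    · simp [diffCount, add_self_two, hb, hb.symm]
  simp [h, ite_pow, sq]

theorem diffCount_ne_one {n : ℕ} (F : (Fin n → ZMod 2) → (Fin n → ZMod 2))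
    {a : Fin n → ZMod 2} (ha : a ≠ 0) (b : Fin n → ZMod 2) : diffCount F a b ≠ 1 := by
  intro h
  obtain ⟨x, hx⟩ := Finset.card_eq_one.1 h
  have hxm : F (x + a) + F x = b := by
    simpa using (Finset.ext_iff.1 hx x).2 (by simp)
  have hxa : x + a = x := by
    refine Finset.mem_singleton.1 ((Finset.ext_iff.1 hx (x + a)).1 ?_)
    rw [Finset.mem_filter, add_assoc, add_self_two, add_zero, add_comm (F x)]
    exact ⟨Finset.mem_univ _, hxm⟩
  exact ha (by simpa using hxa)

theorem diffCount_excess_nonneg {n : ℕ} (F : (Fin n → ZMod 2) → (Fin n → ZMod 2))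
    {a : Fin n → ZMod 2} (ha : a ≠ 0) (b : Fin n → ZMod 2) :
    0 ≤ (diffCount F a b : ℤ) ^ 2 - 2 * diffCount F a b := by
  have h := diffCount_ne_one F ha b
  rcases Nat.lt_or_ge (diffCount F a b) 2 with h2 | h2
  · have h0 : diffCount F a b = 0 := by omega
    simp [h0]
  · have : (2 : ℤ) ≤ diffCount F a b := by exact_mod_cast h2
    nlinarith

theorem isAPN_iff_sum_excess {n : ℕ} (F : (Fin n → ZMod 2) → (Fin n → ZMod 2)) :
    IsAPN F ↔ ∑ a ∈ Finset.univ.erase 0, ∑ b,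
      ((diffCount F a b : ℤ) ^ 2 - 2 * diffCount F a b) = 0 := by
  rw [Finset.sum_eq_zero_iff_of_nonneg fun a ha => Finset.sum_nonneg fun b _ =>
    diffCount_excess_nonneg F (Finset.ne_of_mem_erase ha) b]
  refine forall_congr' fun a => ?_
  simp only [Finset.mem_erase, Finset.mem_univ, and_true]
  refine forall_congr' fun ha => ?_
  rw [Finset.sum_eq_zero_iff_of_nonneg fun b _ => diffCount_excess_nonneg F ha b]
  simp only [Finset.mem_univ, true_imp_iff]
  refine forall_congr' fun b => ?_
  change diffCount F a b ≤ 2 ↔ _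
  have h := diffCount_ne_one F ha b
  have h0 := diffCount_excess_nonneg F ha b
  constructor
  · intro hle
    have : (diffCount F a b : ℤ) ≤ 2 := by exact_mod_cast hle
    nlinarith
  · intro he
    by_contra! hlt
    have : (3 : ℤ) ≤ diffCount F a b := by exact_mod_cast hlt
    nlinarith

theorem sum_sum_diffCount_sq {n : ℕ} (F : (Fin n → ZMod 2) → (Fin n → ZMod 2)) :
    ∑ a, ∑ b, (diffCount F a b : ℤ) ^ 2 =
      2 ^ n * 2 ^ n + 2 * 2 ^ n * (2 ^ n - 1) + ∑ a ∈ Finset.univ.erase 0, ∑ b,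
        ((diffCount F a b : ℤ) ^ 2 - 2 * diffCount F a b) := by
  rw [← Finset.add_sum_erase _ _ (Finset.mem_univ 0), sum_diffCount_zero_sq, add_assoc]
  congr 1
  simp only [Finset.sum_sub_distrib, ← Finset.mul_sum, sum_diffCount, Finset.sum_const]
  rw [Finset.card_erase_of_mem (Finset.mem_univ _), Finset.card_univ, card_cube, nsmul_eq_mul,
    Nat.cast_sub Nat.one_le_two_pow]
  push_cast
  ring

theorem IsBentW.sum_pow_four {n : ℕ} (hne : Even n) {f : (Fin n → ZMod 2) → ZMod 2}
    (hf : IsBentW f) : ∑ u, walsh f u ^ 4 = (2 ^ n) ^ 3 := by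
  have h : ∀ u, walsh f u ^ 4 = 2 ^ n * walsh f u ^ 2 := by
    intro u
    have hsq : walsh f u ^ 2 = 2 ^ n := by
      have hp : ((2 : ℤ) ^ (n / 2)) ^ 2 = 2 ^ n := by
        rw [← pow_mul, Nat.div_mul_cancel hne.two_dvd]
      rcases hf u with h | h <;> simp [h, hp]
    linear_combination walsh f u ^ 2 * hsq
  simp only [h]
  rw [← Finset.mul_sum, sum_walsh_sq]
  ring

theorem IsSemiBentW.sum_pow_four {n : ℕ} (hne : Even n) {f : (Fin n → ZMod 2) → ZMod 2}
    (hf : IsSemiBentW f) : ∑ u, walsh f u ^ 4 = 4 * (2 ^ n) ^ 3 := by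
  have hp : ((2 : ℤ) ^ ((n + 2) / 2)) ^ 2 = 4 * 2 ^ n := by
    rw [← pow_mul, Nat.div_mul_cancel (hne.add even_two).two_dvd]
    ring
  have h : ∀ u, walsh f u ^ 4 = 4 * 2 ^ n * walsh f u ^ 2 := by
    intro u
    rcases hf u with h | h | h <;> rw [h, ← hp] <;> ring
  simp only [h]
  rw [← Finset.mul_sum, sum_walsh_sq]
  ring

theorem sum_walsh_comp_zero_pow_four {n : ℕ} (F : (Fin n → ZMod 2) → (Fin n → ZMod 2)) :
    ∑ u, walsh (comp 0 F) u ^ 4 = (2 ^ n) ^ 4 := by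
  rw [sum_walsh_pow_four]
  simp [autocorr, comp, Dop, signChar_zero, ZMod.card]
  ring

theorem stmt_15 (n : ℕ) (hne : Even n) (hn : 2 ≤ n)
    (Q : (Fin n → ZMod 2) → (Fin n → ZMod 2))
    (hquad : ∀ lam : Fin n → ZMod 2, lam ≠ 0 →
      degLE 2 (comp lam Q) ∧ ¬ degLE 1 (comp lam Q))
    (hbs : ∀ lam : Fin n → ZMod 2, lam ≠ 0 →
      IsBentW (comp lam Q) ∨ IsSemiBentW (comp lam Q)) :
    IsAPN Q ↔
      3 * {lam : Fin n → ZMod 2 | lam ≠ 0 ∧ IsBentW (comp lam Q)}.ncard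
        = 2 * (2 ^ n - 1) := by
  classical
  set B := {lam : Fin n → ZMod 2 | lam ≠ 0 ∧ IsBentW (comp lam Q)} with hB
  have hcard : B.ncard =
      ((Finset.univ.erase 0).filter fun lam => IsBentW (comp lam Q)).card := by
    rw [← Set.ncard_coe_finset]
    congr 1
    ext lam
    simp [hB]
  have hsum : ∑ lam ∈ Finset.univ.erase 0, ∑ u, walsh (comp lam Q) u ^ 4 =
      (2 ^ n) ^ 3 * (4 * (2 ^ n - 1) - 3 * (B.ncard : ℤ)) := by
    have h : ∀ lam ∈ Finset.univ.erase 0, ∑ u, walsh (comp lam Q) u ^ 4 =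
        4 * (2 ^ n) ^ 3 - 3 * (2 ^ n) ^ 3 * (if IsBentW (comp lam Q) then 1 else 0) := by
      intro lam hlam
      split_ifs with hb
      · rw [hb.sum_pow_four hne]
        ring
      · rw [((hbs lam (Finset.ne_of_mem_erase hlam)).resolve_left hb).sum_pow_four hne]
        ring
    rw [Finset.sum_congr rfl h, Finset.sum_sub_distrib, ← Finset.mul_sum, ← Finset.mul_sum,
      Finset.sum_boole, ← hcard, Finset.sum_const, Finset.card_erase_of_mem (Finset.mem_univ _), Finset.card_univ,
      card_cube, nsmul_eq_mul, Nat.cast_sub Nat.one_le_two_pow]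
    push_cast
    ring
  have hmom := sum_sum_walsh_pow_four Q
  rw [← Finset.add_sum_erase _ _ (Finset.mem_univ 0), sum_walsh_comp_zero_pow_four, hsum,
    sum_sum_diffCount_sq] at hmom
  rw [isAPN_iff_sum_excess]
  set E := ∑ a ∈ Finset.univ.erase 0, ∑ b, ((diffCount Q a b : ℤ) ^ 2 - 2 * diffCount Q a b)
  have hq : (2 : ℤ) ^ n ≠ 0 := by positivity
  have hE : E = 2 ^ n * (2 * (2 ^ n - 1) - 3 * (B.ncard : ℤ)) := by
    refine mul_left_cancel₀ (mul_ne_zero hq hq) ?_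
    linear_combination -hmom
  rw [hE, mul_eq_zero, or_iff_right hq, sub_eq_zero, eq_comm, ← Nat.cast_inj (R := ℤ)]
  push_cast [Nat.one_le_two_pow]
  rfl
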